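/- Define K(φ) by ι_{K(φ)v} vol = −ι_v φ ∧ φ, F(φ)(v₁,v₂,v₃) = −2φ(K(φ)v₁, v₂, v₃), and Q(φ) by φ ∧ F(φ) = −Q(φ)·vol. Then for every 3-form φ on ℝ⁶, K(φ) ∘ K(φ) = (Q(φ)/4)·id. -/

import Mathlib

noncomputable section

/-- The model 6-dimensional real vector space. -/
abbrev V6 := Fin 6 → ℝ

/-- Alternating k-forms on V6. -/
abbrev Form (k : ℕ) := AlternatingMap ℝ V6 ℝ (Fin k)

/-- Wedge product of alternating forms (determinant convention). -/
noncomputable def wedge {a b : ℕ} (φ : Form a) (ψ : Form b) : Form (a + b) :=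
  AlternatingMap.domDomCongr finSumFinEquiv
    ((TensorProduct.lid ℝ ℝ).toLinearMap.compAlternatingMap (AlternatingMap.domCoprod φ ψ))

infixl:70 " ⋏ " => wedge

/-- Interior product (contraction) of a form with a vector. -/
noncomputable def iota (v : V6) {k : ℕ} (φ : Form (k + 1)) : Form k :=
  AlternatingMap.curryLeft φ v

/-- The standard dual basis 1-forms e¹, …, e⁶ (0-indexed). -/
noncomputable def e (i : Fin 6) : Form 1 :=
  AlternatingMap.ofSubsingleton ℝ V6 ℝ 0 (LinearMap.proj i)

/-- The standard basis vectors e₁, …, e₆ (0-indexed). -/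
def b (i : Fin 6) : V6 := Pi.single i 1

/-- The standard volume form e¹∧e²∧e³∧e⁴∧e⁵∧e⁶. -/
noncomputable def vol : Form 6 := e 0 ⋏ e 1 ⋏ e 2 ⋏ e 3 ⋏ e 4 ⋏ e 5

open Equiv Equiv.Perm TensorProduct in
/-- The wedge product as a sum over any transversal of the quotient by
`Perm (Fin p) × Perm (Fin q)`. -/
lemma wedge_apply_eq_sum {p q : ℕ} {T : Type} [Fintype T] (r : T → Perm (Fin p ⊕ Fin q))
    (hr : ∀ s t, (∀ x, ((r s)⁻¹ (r t (Sum.inl x))).isLeft) → s = t)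
    (hcard : Fintype.card T * (p.factorial * q.factorial) = (p + q).factorial)
    (α : Form p) (β : Form q) (v : Fin (p + q) → V6) :
    (α ⋏ β) v = ∑ t, ((sign (r t) : ℤ) : ℝ) *
      (α (fun x => v (finSumFinEquiv (r t (Sum.inl x)))) *
        β (fun y => v (finSumFinEquiv (r t (Sum.inr y))))) := by
  have hinj : Function.Injective
      (fun t => (Quotient.mk'' (r t) : ModSumCongr (Fin p) (Fin q))) := by
    intro s t hst
    obtain ⟨⟨σ, τ⟩, h⟩ := QuotientGroup.leftRel_apply.mp (Quotient.exact' hst)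
    refine hr s t fun x => ?_
    have hx := congrFun (congrArg DFunLike.coe h) (Sum.inl x)
    rw [Perm.mul_apply] at hx
    rw [← hx]
    simp
  have hc : Fintype.card T = Fintype.card (ModSumCongr (Fin p) (Fin q)) := by
    have h := Subgroup.card_eq_card_quotient_mul_card_subgroup (sumCongrHom (Fin p) (Fin q)).range
    rw [Nat.card_eq_fintype_card, Nat.card_eq_fintype_card, Nat.card_eq_fintype_card,
      sumCongrHom.card_range, Fintype.card_prod] at h
    simp only [Fintype.card_perm, Fintype.card_sum, Fintype.card_fin] at h
    rw [h] at hcard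
    exact Nat.eq_of_mul_eq_mul_right (by positivity) hcard
  have hbij := (Fintype.bijective_iff_injective_and_card _).2 ⟨hinj, hc⟩
  simp only [wedge, AlternatingMap.domDomCongr_apply, LinearMap.compAlternatingMap_apply,
    AlternatingMap.domCoprod_apply, sum_apply, map_sum]
  refine (Fintype.sum_bijective _ hbij _ _ fun t => ?_).symm
  rw [AlternatingMap.domCoprod.summand_mk'']
  change _ = TensorProduct.lid ℝ ℝ (sign (r t) •
    ((α fun x => v (finSumFinEquiv (r t (Sum.inl x)))) ⊗ₜ[ℝ]
      (β fun y => v (finSumFinEquiv (r t (Sum.inr y))))))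
  rcases Int.units_eq_one_or (sign (r t)) with h | h <;> simp [h]

lemma wedge_e_apply {k : ℕ} (ψ : Form k) (i : Fin 6) (v : Fin (k + 1) → V6)
    (hv : ∀ j : Fin k, v j.castSucc i = 0) :
    (ψ ⋏ e i) v = ψ (fun j => v j.castSucc) * v (Fin.last k) i := by
  rw [wedge_apply_eq_sum (T := Option (Fin k))
    (fun t => t.elim 1 fun j => Equiv.swap (Sum.inl j) (Sum.inr 0)) _ (by simp [Nat.factorial])]
  · rw [Fintype.sum_option, Finset.sum_eq_zero]
    · simp [e, Fin.castSucc, Fin.last]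
      left; rfl
    · intro j _
      have := hv j
      simp_all [e, Fin.castSucc]
  · rintro (_ | s) (_ | t) h
    · rfl
    · simpa using h t
    · simpa using h s
    · by_contra hst
      have := h s
      simp_all [Equiv.swap_apply_def]

lemma vol_b : vol b = 1 := by
  simp only [vol]
  repeat rw [wedge_e_apply _ _ _ (by intro j; fin_cases j <;> simp [b])]
  simp [e, b, Fin.last]

lemma iota_apply {k : ℕ} (φ : Form (k + 1)) (w : V6) (u : Fin k → V6) :
    iota w φ u = φ (Matrix.vecCons w u) := rfl

lemma eq_sum_smul_b (w : V6) : w = ∑ m, w m • b m := by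
  ext i
  simp [b, Finset.sum_apply, Pi.single_apply]

lemma iota_sum_smul_apply {k : ℕ} (φ : Form (k + 1)) (w : V6) (u : Fin k → V6) :
    iota w φ u = ∑ m, w m * iota (b m) φ u := by
  let L : V6 →ₗ[ℝ] ℝ :=
    { toFun := fun w => iota w φ u
      map_add' := fun x y => by simp [iota]
      map_smul' := fun c x => by simp [iota] }
  change L w = ∑ m, w m * L (b m)
  conv_lhs => rw [eq_sum_smul_b w]
  simp only [map_sum, map_smul, smul_eq_mul]

/-- Contracting `vol` with `w` recovers the coordinates of `w`. -/
lemma iota_vol_apply (w : V6) (i : Fin 6) :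
    iota w vol (fun j => b (Equiv.swap 0 i j.succ)) = (if i = 0 then 1 else -1) * w i := by
  rw [iota_sum_smul_apply, Finset.sum_eq_single i]
  · have h : iota (b i) vol (fun j => b (Equiv.swap 0 i j.succ)) = vol (b ∘ Equiv.swap 0 i) := by
      have hv : b ∘ Equiv.swap 0 i =
          Matrix.vecCons (b i) (fun j => b (Equiv.swap 0 i j.succ)) := by
        funext j
        refine Fin.cases ?_ (fun j => ?_) j <;> simp
      rw [iota_apply, hv]
    rw [h, AlternatingMap.map_perm, vol_b]
    rcases eq_or_ne i 0 with rfl | hi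
    · simp
    · simp [Equiv.Perm.sign_swap hi.symm, hi]
  · intro m _ hm
    obtain ⟨j, hj⟩ := Fin.exists_succ_eq.2
      (show Equiv.swap 0 i m ≠ 0 by rwa [Ne, Equiv.swap_apply_eq_iff, Equiv.swap_apply_left])
    rw [iota_apply, vol.map_eq_zero_of_eq _ (i := 0) (j := j.succ)
      (by rw [Matrix.cons_val_zero, Matrix.cons_val_succ, hj, Equiv.swap_apply_self])
      (Fin.succ_ne_zero j).symm, mul_zero]
  · simp

lemma eq_vec_two (f : Fin 2 → V6) : f = ![f 0, f 1] := by
  ext i; fin_cases i <;> rfl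

lemma eq_vec_three (f : Fin 3 → V6) : f = ![f 0, f 1, f 2] := by
  ext i; fin_cases i <;> rfl

open Equiv in
lemma wedge_two_three_apply (α : Form 2) (β : Form 3) (v : Fin 5 → V6) :
    (α ⋏ β) v =
      α ![v 0, v 1] * β ![v 2, v 3, v 4]
      - α ![v 2, v 1] * β ![v 0, v 3, v 4]
      - α ![v 3, v 1] * β ![v 2, v 0, v 4]
      - α ![v 4, v 1] * β ![v 2, v 3, v 0]
      - α ![v 0, v 2] * β ![v 1, v 3, v 4]
      - α ![v 0, v 3] * β ![v 2, v 1, v 4]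
      - α ![v 0, v 4] * β ![v 2, v 3, v 1]
      + α ![v 2, v 3] * β ![v 0, v 1, v 4]
      + α ![v 2, v 4] * β ![v 0, v 3, v 1]
      + α ![v 3, v 4] * β ![v 2, v 0, v 1] := by
  rw [wedge_apply_eq_sum (T := Option (Fin 2 × Fin 3) ⊕ Fin 3)
    (Sum.elim
      (fun t => t.elim 1 fun p => swap (Sum.inl p.1) (Sum.inr p.2))
      ![swap (Sum.inl 0) (Sum.inr 0) * swap (Sum.inl 1) (Sum.inr 1),
        swap (Sum.inl 0) (Sum.inr 0) * swap (Sum.inl 1) (Sum.inr 2),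
        swap (Sum.inl 0) (Sum.inr 1) * swap (Sum.inl 1) (Sum.inr 2)]) (by decide) (by decide)]
  simp only [eq_vec_two (fun x => v _), eq_vec_three (fun x => v _)]
  simp [Fintype.sum_option, Fintype.sum_prod_type, Fin.sum_univ_succ, swap_apply_def,
    show finSumFinEquiv (Sum.inl 0 : Fin 2 ⊕ Fin 3) = 0 from rfl,
    show finSumFinEquiv (Sum.inl 1 : Fin 2 ⊕ Fin 3) = 1 from rfl,
    show finSumFinEquiv (Sum.inr 0 : Fin 2 ⊕ Fin 3) = 2 from rfl,
    show finSumFinEquiv (Sum.inr 1 : Fin 2 ⊕ Fin 3) = 3 from rfl,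
    show finSumFinEquiv (Sum.inr 2 : Fin 2 ⊕ Fin 3) = 4 from rfl]
  ring

open Equiv in
lemma wedge_three_three_apply (α β : Form 3) (v : Fin 6 → V6) :
    (α ⋏ β) v =
      α ![v 0, v 1, v 2] * β ![v 3, v 4, v 5]
      - α ![v 3, v 1, v 2] * β ![v 0, v 4, v 5]
      - α ![v 4, v 1, v 2] * β ![v 3, v 0, v 5]
      - α ![v 5, v 1, v 2] * β ![v 3, v 4, v 0]
      - α ![v 0, v 3, v 2] * β ![v 1, v 4, v 5]
      - α ![v 0, v 4, v 2] * β ![v 3, v 1, v 5]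
      - α ![v 0, v 5, v 2] * β ![v 3, v 4, v 1]
      - α ![v 0, v 1, v 3] * β ![v 2, v 4, v 5]
      - α ![v 0, v 1, v 4] * β ![v 3, v 2, v 5]
      - α ![v 0, v 1, v 5] * β ![v 3, v 4, v 2]
      - α ![v 3, v 4, v 5] * β ![v 0, v 1, v 2]
      + α ![v 0, v 4, v 5] * β ![v 3, v 1, v 2]
      + α ![v 3, v 0, v 5] * β ![v 4, v 1, v 2]
      + α ![v 3, v 4, v 0] * β ![v 5, v 1, v 2]
      + α ![v 1, v 4, v 5] * β ![v 0, v 3, v 2]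
      + α ![v 3, v 1, v 5] * β ![v 0, v 4, v 2]
      + α ![v 3, v 4, v 1] * β ![v 0, v 5, v 2]
      + α ![v 2, v 4, v 5] * β ![v 0, v 1, v 3]
      + α ![v 3, v 2, v 5] * β ![v 0, v 1, v 4]
      + α ![v 3, v 4, v 2] * β ![v 0, v 1, v 5] := by
  rw [wedge_apply_eq_sum (T := Bool × Option (Fin 3 × Fin 3))
    (fun t => t.2.elim 1 (fun p => swap (Sum.inl p.1) (Sum.inr p.2)) *
      bif t.1 then (sumComm (Fin 3) (Fin 3) : Perm (Fin 3 ⊕ Fin 3)) else 1)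
    (by decide) (by decide)]
  simp only [eq_vec_three (fun x => v _)]
  simp [Fintype.sum_option, Fintype.sum_prod_type, Fin.sum_univ_succ, swap_apply_def,
    show Perm.sign (sumComm (Fin 3) (Fin 3)) = -1 by decide,
    show finSumFinEquiv (Sum.inl 0 : Fin 3 ⊕ Fin 3) = 0 from rfl,
    show finSumFinEquiv (Sum.inl 1 : Fin 3 ⊕ Fin 3) = 1 from rfl,
    show finSumFinEquiv (Sum.inl 2 : Fin 3 ⊕ Fin 3) = 2 from rfl,
    show finSumFinEquiv (Sum.inr 0 : Fin 3 ⊕ Fin 3) = 3 from rfl,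
    show finSumFinEquiv (Sum.inr 1 : Fin 3 ⊕ Fin 3) = 4 from rfl,
    show finSumFinEquiv (Sum.inr 2 : Fin 3 ⊕ Fin 3) = 5 from rfl]
  ring

/-- The value of `ι_v φ ∧ φ` on five basis vectors, with `v` a basis vector, in terms of the
coefficients `c` of `φ`. -/
def contractWedge (c : Fin 6 → Fin 6 → Fin 6 → ℝ) (j p q r s t : Fin 6) : ℝ :=
  c j p q * c r s t - c j r q * c p s t - c j s q * c r p t - c j t q * c r s p
    - c j p r * c q s t - c j p s * c r q t - c j p t * c r s q
    + c j r s * c p q t + c j r t * c p s q + c j s t * c r p q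

/-- The `(i, j)` entry of `K(φ)` in terms of the coefficients `c` of `φ`. -/
def KEntry (c : Fin 6 → Fin 6 → Fin 6 → ℝ) (i j : Fin 6) : ℝ :=
  ![-contractWedge c j 1 2 3 4 5, contractWedge c j 0 2 3 4 5, contractWedge c j 1 0 3 4 5,
    contractWedge c j 1 2 0 4 5, contractWedge c j 1 2 3 0 5, contractWedge c j 1 2 3 4 0] i

/-- The coefficient at `vol` of the wedge product of the 3-forms with coefficients `c` and `f`. -/
def wedgeCoeff (c f : Fin 6 → Fin 6 → Fin 6 → ℝ) : ℝ :=
      c 0 1 2 * f 3 4 5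
      - c 3 1 2 * f 0 4 5
      - c 4 1 2 * f 3 0 5
      - c 5 1 2 * f 3 4 0
      - c 0 3 2 * f 1 4 5
      - c 0 4 2 * f 3 1 5
      - c 0 5 2 * f 3 4 1
      - c 0 1 3 * f 2 4 5
      - c 0 1 4 * f 3 2 5
      - c 0 1 5 * f 3 4 2
      - c 3 4 5 * f 0 1 2
      + c 0 4 5 * f 3 1 2
      + c 3 0 5 * f 4 1 2
      + c 3 4 0 * f 5 1 2
      + c 1 4 5 * f 0 3 2
      + c 3 1 5 * f 0 4 2
      + c 3 4 1 * f 0 5 2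
      + c 2 4 5 * f 0 1 3
      + c 3 2 5 * f 0 1 4
      + c 3 4 2 * f 0 1 5

set_option maxHeartbeats 4000000 in
/-- With `K` the endomorphism attached to `φ`, the matrix `K ^ 2` is a multiple of the identity. -/
lemma sum_KEntry_mul_KEntry_eq_ite (c : Fin 6 → Fin 6 → Fin 6 → ℝ)
    (h₁ : ∀ i j k, c i j k = -c j i k) (h₂ : ∀ i j k, c i j k = -c i k j) (i j : Fin 6) :
    ∑ m, KEntry c i m * KEntry c m j =
      if i = j then ∑ m, KEntry c 0 m * KEntry c m 0 else 0 := by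
  have z₁ : ∀ i k, c i i k = 0 := fun i k => by linarith [h₁ i i k]
  have z₂ : ∀ i k, c i k i = 0 := fun i k => by rw [h₂, z₁, neg_zero]
  have s₁ : ∀ i j k, j < i → c i j k = -c j i k := fun i j k _ => h₁ i j k
  have s₂ : ∀ i j k, k < j → c i j k = -c i k j := fun i j k _ => h₂ i j k
  clear h₁ h₂
  simp only [Fin.sum_univ_six, KEntry, Matrix.cons_val]
  fin_cases i <;> fin_cases j <;>
    simp only [Fin.zero_eta, Fin.mk_one, Fin.reduceFinMk, Matrix.cons_val, Fin.reduceEq, reduceIte,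
      contractWedge, z₁, z₂, Fin.reduceLT, s₁, s₂] <;>
    ring

set_option maxHeartbeats 4000000 in
lemma wedgeCoeff_sum_KEntry_mul (c : Fin 6 → Fin 6 → Fin 6 → ℝ)
    (h₁ : ∀ i j k, c i j k = -c j i k) (h₂ : ∀ i j k, c i j k = -c i k j) :
    wedgeCoeff c (fun i j k => ∑ m, KEntry c m i * c m j k) =
      2 * ∑ m, KEntry c 0 m * KEntry c m 0 := by
  have z₁ : ∀ i k, c i i k = 0 := fun i k => by linarith [h₁ i i k]
  have z₂ : ∀ i k, c i k i = 0 := fun i k => by rw [h₂, z₁, neg_zero]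
  have s₁ : ∀ i j k, j < i → c i j k = -c j i k := fun i j k _ => h₁ i j k
  have s₂ : ∀ i j k, k < j → c i j k = -c i k j := fun i j k _ => h₂ i j k
  clear h₁ h₂
  simp only [Fin.sum_univ_six, KEntry, Matrix.cons_val, wedgeCoeff]
  simp only [contractWedge, z₁, z₂, Fin.reduceLT, s₁, s₂]
  ring

lemma map_b_swap_left (φ : Form 3) (i j k : Fin 6) :
    φ ![b i, b j, b k] = -φ ![b j, b i, b k] := by
  rw [← φ.map_swap _ (show (0 : Fin 3) ≠ 1 by decide)]
  congr 1
  funext m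
  fin_cases m <;> rfl

lemma map_b_swap_right (φ : Form 3) (i j k : Fin 6) :
    φ ![b i, b j, b k] = -φ ![b i, b k, b j] := by
  rw [← φ.map_swap _ (show (1 : Fin 3) ≠ 2 by decide)]
  congr 1
  funext m
  fin_cases m <;> rfl

lemma apply_b_eq_KEntry {φ : Form 3} {K : V6 →ₗ[ℝ] V6}
    (hK : ∀ v : V6, iota (K v) vol = -(iota v φ ⋏ φ)) (i j : Fin 6) :
    K (b j) i = KEntry (fun i j k => φ ![b i, b j, b k]) i j := by
  have h := DFunLike.congr_fun (hK (b j)) (fun m => b (Equiv.swap 0 i m.succ))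
  rw [iota_vol_apply, AlternatingMap.neg_apply, wedge_two_three_apply] at h
  simp only [iota_apply] at h
  fin_cases i <;> simp [Equiv.swap_apply_def, KEntry, contractWedge] at h ⊢ <;> linarith

/-- With K(φ) defined by ι_{K v} vol = −ι_v φ ∧ φ, F(φ) by
F(v₁,v₂,v₃) = −2 φ(K v₁, v₂, v₃) (equivalently ι_v F = −2 ι_{K v} φ), and Q(φ) by
φ ∧ F(φ) = −Q(φ)·vol, every 3-form φ satisfies K ∘ K = (Q/4)·id. -/
theorem Ksquare_eq_Q_div_four (φ F : Form 3) (K : V6 →ₗ[ℝ] V6) (Q : ℝ)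
    (hK : ∀ v : V6, iota (K v) vol = -(iota v φ ⋏ φ))
    (hF : ∀ v : V6, iota v F = (-2 : ℝ) • iota (K v) φ)
    (hQ : (φ ⋏ F : Form 6) = (-Q) • vol) :
    K ∘ₗ K = (Q / 4) • LinearMap.id := by
  let c : Fin 6 → Fin 6 → Fin 6 → ℝ := fun i j k => φ ![b i, b j, b k]
  have hKc : ∀ i j, K (b j) i = KEntry c i j := apply_b_eq_KEntry hK
  have hFc : ∀ i j k, F ![b i, b j, b k] = -2 * ∑ m, KEntry c m i * c m j k := by
    intro i j k
    have h := DFunLike.congr_fun (hF (b i)) ![b j, b k]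
    rw [AlternatingMap.smul_apply, iota_sum_smul_apply φ] at h
    simpa only [iota_apply, smul_eq_mul, hKc] using h
  have hQc : 2 * ∑ m, KEntry c 0 m * KEntry c m 0 = Q / 2 := by
    rw [← wedgeCoeff_sum_KEntry_mul c (map_b_swap_left φ) (map_b_swap_right φ)]
    have h := DFunLike.congr_fun hQ b
    rw [wedge_three_three_apply, AlternatingMap.smul_apply, vol_b, smul_eq_mul] at h
    simp only [hFc] at h
    simp only [wedgeCoeff]
    linarith
  have hexp : ∀ w i, K w i = ∑ m, KEntry c i m * w m := by
    intro w i
    conv_lhs => rw [eq_sum_smul_b w]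
    simp [hKc, mul_comm]
  refine LinearMap.pi_ext' fun j => LinearMap.ext_ring (funext fun i => ?_)
  change K (K (b j)) i = Q / 4 * b j i
  simp only [hexp (K (b j)), hKc]
  rw [sum_KEntry_mul_KEntry_eq_ite c (map_b_swap_left φ) (map_b_swap_right φ)]
  rcases eq_or_ne i j with rfl | hij
  · rw [if_pos rfl, b, Pi.single_eq_same]
    linarith
  · simp [b, hij]
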